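/- Let q ≥ 3 be a prime power, let m ≥ 5 be odd, and set s = (m-1)/2. Then for every integer i with -q^s + 1 ≤ i ≤ 2q^s, the q-weight of q^{m-1} + (q^s - 1)·i (a nonnegative integer in this range) is given by: 1 + (q-1)·(s - v_q(-i)) if -q^s + 1 ≤ i ≤ -1; 1 if i = 0; 1 + (q-1)·s if 1 ≤ i ≤ q^s; 1 + (q-1)·(m-1) if i = q^s + 1; and 1 + (q-1)·(s + v_q(i - q^s - 1)) if q^s + 2 ≤ i ≤ 2q^s. Here v_q(j) denotes the q-adic valuation of the positive integer j. -/

import Mathlib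

/-- The `q`-weight of a natural number: the sum of its base-`q` digits. -/
def wtq (q i : ℕ) : ℕ := (Nat.digits q i).sum

lemma wtq_zero (q : ℕ) : wtq q 0 = 0 := by simp [wtq]

lemma wtq_add_mul {q a : ℕ} (hq : 2 ≤ q) (ha : a < q) (b : ℕ) :
    wtq q (a + q * b) = a + wtq q b := by
  by_cases h : a + q * b = 0
  · have hb : b = 0 := by
      rcases Nat.mul_eq_zero.mp (by omega : q * b = 0) with h | h <;> omega
    subst hb
    have : a = 0 := by omega
    subst this
    simp
  · unfold wtq
    rw [Nat.digits_def' (by omega) (by omega), Nat.add_mul_mod_self_left, Nat.mod_eq_of_lt ha,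
      Nat.add_mul_div_left _ _ (by omega), Nat.div_eq_of_lt ha]
    simp

lemma wtq_eq_mod_add_div {q : ℕ} (hq : 2 ≤ q) (n : ℕ) :
    wtq q n = n % q + wtq q (n / q) := by
  conv_lhs => rw [← Nat.mod_add_div n q]
  exact wtq_add_mul hq (Nat.mod_lt _ (by omega)) _

lemma wtq_of_lt {q a : ℕ} (hq : 2 ≤ q) (ha : a < q) : wtq q a = a := by
  simpa [wtq_zero] using wtq_add_mul hq ha 0

lemma wtq_add_pow_mul {q : ℕ} (hq : 2 ≤ q) (s : ℕ) {a : ℕ} (ha : a < q ^ s) (b : ℕ) :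
    wtq q (a + q ^ s * b) = wtq q a + wtq q b := by
  induction s generalizing a with
  | zero =>
    have : a = 0 := by simpa using ha
    simp [this, wtq_zero]
  | succ s ih =>
    have hr : a % q < q := Nat.mod_lt _ (by omega)
    have hd : a / q < q ^ s := Nat.div_lt_of_lt_mul (by rwa [pow_succ'] at ha)
    have h1 : a + q ^ (s + 1) * b = a % q + q * (a / q + q ^ s * b) := by
      conv_lhs => rw [← Nat.mod_add_div a q]
      ring
    rw [h1, wtq_add_mul hq hr, ih hd, wtq_eq_mod_add_div hq a, add_assoc]

lemma wtq_add_wtq_of_add_eq {q : ℕ} (hq : 2 ≤ q) (s : ℕ) {a b : ℕ} (hab : a + b + 1 = q ^ s) :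
    wtq q a + wtq q b = (q - 1) * s := by
  induction s generalizing a b with
  | zero =>
    obtain ⟨rfl, rfl⟩ : a = 0 ∧ b = 0 := by simp at hab; omega
    simp [wtq_zero]
  | succ s ih =>
    have ha := Nat.mod_add_div a q
    have hb := Nat.mod_add_div b q
    have hra : a % q < q := Nat.mod_lt _ (by omega)
    have hrb : b % q < q := Nat.mod_lt _ (by omega)
    rw [pow_succ'] at hab
    have hdvd : q ∣ a % q + b % q + 1 := by
      have h1 : q ∣ (a % q + b % q + 1) + q * (a / q + b / q) :=
        ⟨q ^ s, by rw [← hab, mul_add]; omega⟩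
      exact (Nat.dvd_add_left ⟨_, rfl⟩).mp h1
    have hsum : a % q + b % q + 1 = q := by
      obtain ⟨c, hc⟩ := hdvd
      have hc1 : c = 1 := by
        have : c < 2 := by
          by_contra! h
          have := Nat.mul_le_mul_left q h
          omega
        have : c ≠ 0 := by rintro rfl; omega
        omega
      rw [hc, hc1, mul_one]
    have hquot : a / q + b / q + 1 = q ^ s := by
      apply Nat.eq_of_mul_eq_mul_left (show 0 < q by omega)
      rw [← hab, mul_add, mul_add]
      omega
    rw [wtq_eq_mod_add_div hq a, wtq_eq_mod_add_div hq b, mul_add, ← ih hquot]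
    omega

lemma wtq_pos {q : ℕ} (hq : 2 ≤ q) {n : ℕ} (hn : 0 < n) : 0 < wtq q n := by
  induction n using Nat.strong_induction_on with
  | _ n ih =>
    rw [wtq_eq_mod_add_div hq n]
    rcases Nat.eq_zero_or_pos (n % q) with h | h
    · have hd : 0 < n / q := Nat.div_pos (Nat.le_of_dvd hn (Nat.dvd_of_mod_eq_zero h)) (by omega)
      have := ih (n / q) (Nat.div_lt_self hn (by omega)) hd
      omega
    · omega

lemma wtq_succ_add_padicValNat {q : ℕ} (hq : 2 ≤ q) (n : ℕ) :
    wtq q (n + 1) + (q - 1) * padicValNat q (n + 1) = wtq q n + 1 := by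
  have hfin : FiniteMultiplicity q (n + 1) := Nat.finiteMultiplicity_iff.mpr (by omega)
  have hv : padicValNat q (n + 1) = multiplicity q (n + 1) := padicValNat_def' (by omega) (by omega)
  obtain ⟨c, hc, hndvd⟩ := hfin.exists_eq_pow_mul_and_not_dvd
  rw [← hv] at hc
  set v := padicValNat q (n + 1)
  have hpos : 0 < q ^ v := pow_pos (by omega) _
  obtain ⟨d, rfl⟩ : ∃ d, c = d + 1 :=
    Nat.exists_eq_succ_of_ne_zero (by rintro rfl; simp at hc)
  have hn : n = (q ^ v - 1) + q ^ v * d := by rw [mul_add] at hc; omega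
  have h1 : wtq q (n + 1) = wtq q (d + 1) := by
    rw [hc]
    simpa [wtq_zero] using wtq_add_pow_mul hq v hpos (d + 1)
  have h2 : wtq q n = (q - 1) * v + wtq q d := by
    rw [hn, wtq_add_pow_mul hq v (by omega)]
    congr 1
    simpa [wtq_zero] using wtq_add_wtq_of_add_eq hq v (a := q ^ v - 1) (b := 0) (by omega)
  have h3 : wtq q (d + 1) = wtq q d + 1 := by
    have hd := Nat.mod_add_div d q
    have hr : d % q < q := Nat.mod_lt _ (by omega)
    have hr' : d % q + 1 < q := by
      by_contra! h
      refine hndvd ⟨d / q + 1, ?_⟩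
      rw [mul_add]
      omega
    have h4 : wtq q (d + 1) = d % q + 1 + wtq q (d / q) := by
      rw [← wtq_add_mul hq hr']
      congr 1
      omega
    have h5 := wtq_eq_mod_add_div hq d
    omega
  omega


/-- Let `q ≥ 3` be a prime power, `m ≥ 5` odd, and `s = (m-1)/2`. Then for
every integer `i` with `-q^s + 1 ≤ i ≤ 2q^s`, the `q`-weight of
`x = q^{m-1} + (q^s - 1)·i` is:
`1 + (q-1)(s - v_q(-i))` if `-q^s + 1 ≤ i ≤ -1`; `1` if `i = 0`;
`1 + (q-1)s` if `1 ≤ i ≤ q^s`; `1 + (q-1)(m-1)` if `i = q^s + 1`; and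
`1 + (q-1)(s + v_q(i - q^s - 1))` if `q^s + 2 ≤ i ≤ 2q^s`,
where `v_q` denotes the `q`-adic valuation. -/
theorem stmt18 (q m : ℕ) (hq : 3 ≤ q) (hpp : IsPrimePow q)
    (hm : 5 ≤ m) (hmo : Odd m) (s : ℕ) (hs : s = (m - 1) / 2)
    (i : ℤ) (hi1 : -(q : ℤ) ^ s + 1 ≤ i) (hi2 : i ≤ 2 * (q : ℤ) ^ s) :
    ∀ x : ℤ, x = (q : ℤ) ^ (m - 1) + ((q : ℤ) ^ s - 1) * i →
      (i ≤ -1 →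
        wtq q x.toNat = 1 + (q - 1) * (s - padicValNat q (-i).toNat)) ∧
      (i = 0 → wtq q x.toNat = 1) ∧
      (1 ≤ i → i ≤ (q : ℤ) ^ s → wtq q x.toNat = 1 + (q - 1) * s) ∧
      (i = (q : ℤ) ^ s + 1 → wtq q x.toNat = 1 + (q - 1) * (m - 1)) ∧
      ((q : ℤ) ^ s + 2 ≤ i →
        wtq q x.toNat
          = 1 + (q - 1) * (s + padicValNat q (i - (q : ℤ) ^ s - 1).toNat)) := by
  have hq2 : 2 ≤ q := by omega
  have hms : m - 1 = s + s := by
    obtain ⟨k, rfl⟩ := hmo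
    omega
  intro x hx
  rw [hms, pow_add] at hx
  have hQpos : 0 < q ^ s := pow_pos (by omega) _
  have hQ : ((q ^ s : ℕ) : ℤ) = (q : ℤ) ^ s := by push_cast; rfl
  rw [← hQ] at hx hi1 hi2 ⊢
  have split : ∀ a b c : ℕ, a < q ^ s → b < q ^ s → c < q →
      wtq q (a + q ^ s * (b + q ^ s * c)) = wtq q a + wtq q b + c := fun a b c ha hb hc => by
    rw [wtq_add_pow_mul hq2 s ha, wtq_add_pow_mul hq2 s hb, wtq_of_lt hq2 hc, add_assoc]
  have compl : ∀ a b : ℕ, a + b + 1 = q ^ s → wtq q a + wtq q b = (q - 1) * s :=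
    fun a b => wtq_add_wtq_of_add_eq hq2 s
  generalize q ^ s = Q at *
  refine ⟨fun h => ?_, fun h => ?_, fun h1 h2 => ?_, fun h => ?_, fun h => ?_⟩
  · obtain ⟨j, rfl⟩ : ∃ j : ℕ, i = -((j + 1 : ℕ) : ℤ) := ⟨(-i - 1).toNat, by omega⟩
    obtain ⟨k, rfl⟩ : ∃ k : ℕ, Q = j + k + 1 := ⟨Q - j - 1, by omega⟩
    have hxe : x.toNat = (j + 1) + (j + k + 1) * (k + (j + k + 1) * 0) := by
      have : x = (((j + 1) + (j + k + 1) * (k + (j + k + 1) * 0) : ℕ) : ℤ) := by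
        rw [hx]; push_cast; ring
      rw [this, Int.toNat_natCast]
    have hw := wtq_succ_add_padicValNat hq2 j
    rw [hxe, split _ _ _ (by omega) (by omega) (by omega), neg_neg, Int.toNat_natCast,
      Nat.mul_sub]
    have := compl j k rfl
    have hpos : 0 < wtq q (j + 1) := wtq_pos hq2 j.succ_pos
    omega
  · subst h
    have hxe : x.toNat = 0 + Q * (0 + Q * 1) := by
      have : x = ((0 + Q * (0 + Q * 1) : ℕ) : ℤ) := by rw [hx]; push_cast; ring
      rw [this, Int.toNat_natCast]
    rw [hxe, split _ _ _ hQpos hQpos (by omega), wtq_zero]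
  · obtain ⟨j, rfl⟩ : ∃ j : ℕ, i = ((j + 1 : ℕ) : ℤ) := ⟨(i - 1).toNat, by omega⟩
    obtain ⟨k, rfl⟩ : ∃ k : ℕ, Q = j + k + 1 := ⟨Q - j - 1, by omega⟩
    have hxe : x.toNat = k + (j + k + 1) * (j + (j + k + 1) * 1) := by
      have : x = ((k + (j + k + 1) * (j + (j + k + 1) * 1) : ℕ) : ℤ) := by
        rw [hx]; push_cast; ring
      rw [this, Int.toNat_natCast]
    rw [hxe, split _ _ _ (by omega) (by omega) (by omega), ← compl j k rfl]
    ring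
  · subst h
    obtain ⟨k, rfl⟩ : ∃ k : ℕ, Q = k + 1 := ⟨Q - 1, by omega⟩
    have hxe : x.toNat = k + (k + 1) * (k + (k + 1) * 1) := by
      have : x = ((k + (k + 1) * (k + (k + 1) * 1) : ℕ) : ℤ) := by
        rw [hx]; push_cast; ring
      rw [this, Int.toNat_natCast]
    have hk := compl k 0 rfl
    rw [wtq_zero, add_zero] at hk
    rw [hxe, split _ _ _ (by omega) (by omega) (by omega), hk, hms]
    ring
  · obtain ⟨j, rfl⟩ : ∃ j : ℕ, i = Q + 1 + ((j + 1 : ℕ) : ℤ) := ⟨(i - Q - 2).toNat, by omega⟩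
    obtain ⟨k, rfl⟩ : ∃ k : ℕ, Q = j + 1 + k + 1 := ⟨Q - j - 2, by omega⟩
    have hxe : x.toNat = k + (j + 1 + k + 1) * (j + (j + 1 + k + 1) * 2) := by
      have : x = ((k + (j + 1 + k + 1) * (j + (j + 1 + k + 1) * 2) : ℕ) : ℤ) := by
        rw [hx]; push_cast; ring
      rw [this, Int.toNat_natCast]
    have hv : (((j + 1 + k + 1 : ℕ) : ℤ) + 1 + ((j + 1 : ℕ) : ℤ) - ((j + 1 + k + 1 : ℕ) : ℤ)
        - 1).toNat = j + 1 := by omega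
    have hw := wtq_succ_add_padicValNat hq2 j
    have := compl (j + 1) k rfl
    rw [hxe, split _ _ _ (by omega) (by omega) (by omega), hv, mul_add]
    omega
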